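/- Let R be a left GF-closed ring with l.Gwdim(R) < ∞ and let n be a positive integer. Then l.Gwdim(R) ≤ n if and only if fd_R(E') ≤ n for every right R-module E' with finite injective dimension. -/

import Mathlib

/-!
Background definitions for D. Bennis, "Weak Gorenstein global dimensions".

Conventions.  All rings are associative with identity.  A *left* `R`-module is a type with
`[AddCommGroup M] [Module R M]`; a *right* `R`-module is a left module over the opposite ring,
i.e. `[Module Rᵐᵒᵖ M]`.  All "right-handed" notions below are obtained by applying the
corresponding "left-handed" notion to the opposite ring `Rᵐᵒᵖ`.
-/

open MulOpposite

universe u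

section Tensor

variable (S : Type u) [Ring S]

/-- The subgroup of relations defining the tensor product `A ⊗_S M` of a right `S`-module `A`
and a left `S`-module `M` over a (possibly noncommutative) ring `S`. -/
def tensorRels (A : Type u) [AddCommGroup A] [Module Sᵐᵒᵖ A]
    (M : Type u) [AddCommGroup M] [Module S M] :
    AddSubgroup (FreeAbelianGroup (A × M)) :=
  AddSubgroup.closure
    { x | (∃ a₁ a₂ m, x = FreeAbelianGroup.of (a₁ + a₂, m) - FreeAbelianGroup.of (a₁, m) -
            FreeAbelianGroup.of (a₂, m)) ∨
          (∃ a m₁ m₂, x = FreeAbelianGroup.of (a, m₁ + m₂) - FreeAbelianGroup.of (a, m₁) -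
            FreeAbelianGroup.of (a, m₂)) ∨
          (∃ (a : A) (r : S) (m : M), x = FreeAbelianGroup.of (op r • a, m) - FreeAbelianGroup.of (a, r • m)) }

/-- The tensor product `A ⊗_S M` (an abelian group) of a right `S`-module `A` and a left
`S`-module `M` over a (possibly noncommutative) ring `S`. -/
def NTensor (A : Type u) [AddCommGroup A] [Module Sᵐᵒᵖ A]
    (M : Type u) [AddCommGroup M] [Module S M] : Type u :=
  FreeAbelianGroup (A × M) ⧸ tensorRels S A M

instance (A : Type u) [AddCommGroup A] [Module Sᵐᵒᵖ A]
    (M : Type u) [AddCommGroup M] [Module S M] : AddCommGroup (NTensor S A M) :=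
  QuotientAddGroup.Quotient.addCommGroup _

namespace NTensor

variable {S}
variable {A A' : Type u} [AddCommGroup A] [Module Sᵐᵒᵖ A] [AddCommGroup A'] [Module Sᵐᵒᵖ A']
variable {M M' : Type u} [AddCommGroup M] [Module S M] [AddCommGroup M'] [Module S M']

/-- Functoriality of `A ⊗_S −` : the map `A ⊗_S M → A ⊗_S M'` induced by a linear map
`g : M → M'` of left `S`-modules. -/
def rmap (A : Type u) [AddCommGroup A] [Module Sᵐᵒᵖ A] (g : M →ₗ[S] M') :
    NTensor S A M →+ NTensor S A M' :=
  QuotientAddGroup.map (tensorRels S A M) (tensorRels S A M') (FreeAbelianGroup.map (Prod.map id g)) (by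
    simp only [tensorRels]
    refine (AddSubgroup.closure_le _).2 ?_
    rintro x (⟨a₁, a₂, m, rfl⟩ | ⟨a, m₁, m₂, rfl⟩ | ⟨a, r, m, rfl⟩) <;>
      refine SetLike.mem_coe.2 (AddSubgroup.mem_comap.2 (AddSubgroup.subset_closure ?_)) <;>
      simp only [map_sub, map_add, map_smul, FreeAbelianGroup.map_of_apply, Prod.map_apply,
        id_eq, Set.mem_setOf_eq]
    · exact Or.inl ⟨a₁, a₂, g m, rfl⟩
    · exact Or.inr (Or.inl ⟨a, g m₁, g m₂, rfl⟩)
    · exact Or.inr (Or.inr ⟨a, r, g m, rfl⟩))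

/-- Functoriality of `− ⊗_S M` : the map `A ⊗_S M → A' ⊗_S M` induced by a linear map
`f : A → A'` of right `S`-modules. -/
def lmap (M : Type u) [AddCommGroup M] [Module S M] (f : A →ₗ[Sᵐᵒᵖ] A') :
    NTensor S A M →+ NTensor S A' M :=
  QuotientAddGroup.map (tensorRels S A M) (tensorRels S A' M) (FreeAbelianGroup.map (Prod.map f id)) (by
    simp only [tensorRels]
    refine (AddSubgroup.closure_le _).2 ?_
    rintro x (⟨a₁, a₂, m, rfl⟩ | ⟨a, m₁, m₂, rfl⟩ | ⟨a, r, m, rfl⟩) <;>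
      refine SetLike.mem_coe.2 (AddSubgroup.mem_comap.2 (AddSubgroup.subset_closure ?_)) <;>
      simp only [map_sub, map_add, map_smul, FreeAbelianGroup.map_of_apply, Prod.map_apply,
        id_eq, Set.mem_setOf_eq]
    · exact Or.inl ⟨f a₁, f a₂, m, rfl⟩
    · exact Or.inr (Or.inl ⟨f a, m₁, m₂, rfl⟩)
    · exact Or.inr (Or.inr ⟨f a, r, m, rfl⟩))

end NTensor

end Tensor

section Dims

variable (S : Type u) [Ring S]

/-- A left `S`-module `M` is *flat* if tensoring with it preserves injectivity of maps of
right `S`-modules. -/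
def IsFlatMod (M : ModuleCat.{u} S) : Prop :=
  ∀ (A B : Type u) [AddCommGroup A] [Module Sᵐᵒᵖ A] [AddCommGroup B] [Module Sᵐᵒᵖ B]
    (f : A →ₗ[Sᵐᵒᵖ] B), Function.Injective f →
      Function.Injective (NTensor.lmap (↥M) f)

/-- A left `S`-module `M` is *Gorenstein flat* if there is an exact sequence
`⋯ → F (-1) → F 0 → F 1 → ⋯` of flat left `S`-modules with `M ≅ Im (F 0 → F 1)` which stays
exact after applying `I ⊗_S −` for every injective right `S`-module `I`
(a *complete flat resolution*). -/
def IsGorensteinFlat (M : ModuleCat.{u} S) : Prop :=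
  ∃ (F : ℤ → ModuleCat.{u} S) (d : ∀ n : ℤ, ↥(F n) →ₗ[S] ↥(F (n + 1))),
    (∀ n, IsFlatMod S (F n)) ∧
    (∀ n, Function.Exact (d n) (d (n + 1))) ∧
    Nonempty (↥M ≃ₗ[S] ↥(LinearMap.range (d 0))) ∧
    (∀ (I : Type u) [AddCommGroup I] [Module Sᵐᵒᵖ I], Module.Injective Sᵐᵒᵖ I →
      ∀ n, Function.Exact (NTensor.rmap I (d n)) (NTensor.rmap I (d (n + 1))))

/-- `gflatDimLE S n M` means `Gfd_S(M) ≤ n`: there is an exact sequence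
`0 → G_n → ⋯ → G_0 → M → 0` of left `S`-modules with all `G_i` Gorenstein flat. -/
def gflatDimLE : ℕ → ModuleCat.{u} S → Prop
  | 0, M => IsGorensteinFlat S M
  | n + 1, M => ∃ (K G : ModuleCat.{u} S) (ι : ↥K →ₗ[S] ↥G) (π : ↥G →ₗ[S] ↥M),
      Function.Injective ι ∧ Function.Surjective π ∧ Function.Exact ι π ∧
      IsGorensteinFlat S G ∧ gflatDimLE n K

/-- `flatDimLE S n M` means `fd_S(M) ≤ n`: there is an exact sequence
`0 → F_n → ⋯ → F_0 → M → 0` of left `S`-modules with all `F_i` flat. -/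
def flatDimLE : ℕ → ModuleCat.{u} S → Prop
  | 0, M => IsFlatMod S M
  | n + 1, M => ∃ (K F : ModuleCat.{u} S) (ι : ↥K →ₗ[S] ↥F) (π : ↥F →ₗ[S] ↥M),
      Function.Injective ι ∧ Function.Surjective π ∧ Function.Exact ι π ∧
      IsFlatMod S F ∧ flatDimLE n K

/-- `injDimLE S n M` means `id_S(M) ≤ n`: there is an exact sequence
`0 → M → I^0 → ⋯ → I^n → 0` of left `S`-modules with all `I^i` injective. -/
def injDimLE : ℕ → ModuleCat.{u} S → Prop
  | 0, M => Module.Injective S ↥M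
  | n + 1, M => ∃ (I C : ModuleCat.{u} S) (ι : ↥M →ₗ[S] ↥I) (π : ↥I →ₗ[S] ↥C),
      Function.Injective ι ∧ Function.Surjective π ∧ Function.Exact ι π ∧
      Module.Injective S ↥I ∧ injDimLE n C

/-- The Gorenstein flat dimension `Gfd_S(M) ∈ ℕ∞` of a left `S`-module `M`. -/
noncomputable def gflatDim (M : ModuleCat.{u} S) : ℕ∞ :=
  sInf {d : ℕ∞ | ∃ n : ℕ, d = n ∧ gflatDimLE S n M}

/-- The flat dimension `fd_S(M) ∈ ℕ∞` of a left `S`-module `M`. -/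
noncomputable def flatDim (M : ModuleCat.{u} S) : ℕ∞ :=
  sInf {d : ℕ∞ | ∃ n : ℕ, d = n ∧ flatDimLE S n M}

/-- The injective dimension `id_S(M) ∈ ℕ∞` of a left `S`-module `M`. -/
noncomputable def injDim (M : ModuleCat.{u} S) : ℕ∞ :=
  sInf {d : ℕ∞ | ∃ n : ℕ, d = n ∧ injDimLE S n M}

/-- The left weak Gorenstein global dimension
`l.Gwdim(S) = sup { Gfd_S(M) | M a left S-module }`.  The right weak Gorenstein global
dimension of `S` is `gorensteinWeakGlobalDim Sᵐᵒᵖ`. -/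
noncomputable def gorensteinWeakGlobalDim : ℕ∞ :=
  ⨆ M : ModuleCat.{u} S, gflatDim S M

/-- The left weak global dimension `sup { fd_S(M) | M a left S-module }`.  (By a classical
theorem it agrees with `weakGlobalDim Sᵐᵒᵖ`, and the common value is `wdim S`.) -/
noncomputable def weakGlobalDim : ℕ∞ :=
  ⨆ M : ModuleCat.{u} S, flatDim S M

/-- The left finitistic flat dimension
`l.FFD(S) = sup { fd_S(M) | M a left S-module with fd_S(M) < ∞ }`. -/
noncomputable def finitisticFlatDim : ℕ∞ :=
  sSup {d : ℕ∞ | d ≠ ⊤ ∧ ∃ M : ModuleCat.{u} S, flatDim S M = d}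

/-- The left finitistic Gorenstein flat dimension
`l.FGFD(S) = sup { Gfd_S(M) | M a left S-module with Gfd_S(M) < ∞ }`. -/
noncomputable def finitisticGFlatDim : ℕ∞ :=
  sSup {d : ℕ∞ | d ≠ ⊤ ∧ ∃ M : ModuleCat.{u} S, gflatDim S M = d}

/-- A ring `S` is *left GF-closed* if the class of Gorenstein flat left `S`-modules is closed
under extensions.  `S` is right GF-closed iff `Sᵐᵒᵖ` is left GF-closed, and GF-closed if both. -/
def IsGFClosed : Prop :=
  ∀ (A B C : ModuleCat.{u} S) (f : ↥A →ₗ[S] ↥B) (g : ↥B →ₗ[S] ↥C),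
    Function.Injective f → Function.Surjective g → Function.Exact f g →
      IsGorensteinFlat S A → IsGorensteinFlat S C → IsGorensteinFlat S B

/-- A ring `S` is *left coherent* if every finitely generated left ideal of `S` is finitely
presented (as a left `S`-module).  `S` is right coherent iff `Sᵐᵒᵖ` is left coherent. -/
def IsLeftCoherent : Prop :=
  ∀ I : Submodule S S, I.FG → Module.FinitePresentation S ↥I

/-- A ring `S` is *left IF* if every injective left `S`-module is flat.  `S` is right IF iff
`Sᵐᵒᵖ` is left IF, and IF if both. -/
def IsLeftIF : Prop :=
  ∀ E : ModuleCat.{u} S, Module.Injective S ↥E → IsFlatMod S E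

/-- A ring `S` is *left `n`-IF* if `fd_S(E) ≤ n` for every injective left `S`-module `E`.
`S` is right `n`-IF iff `Sᵐᵒᵖ` is left `n`-IF, and `n`-IF if both. -/
def IsLeftNIF (n : ℕ) : Prop :=
  ∀ E : ModuleCat.{u} S, Module.Injective S ↥E → flatDim S E ≤ (n : ℕ∞)

/-- `Ext¹_S(T, K) = 0`, expressed by its standard characterization: every extension of `T`
by `K` (i.e. every short exact sequence `0 → K → X → T → 0`) splits. -/
def Ext1Zero (T K : ModuleCat.{u} S) : Prop :=
  ∀ (X : ModuleCat.{u} S) (ι : ↥K →ₗ[S] ↥X) (π : ↥X →ₗ[S] ↥T),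
    Function.Injective ι → Function.Surjective π → Function.Exact ι π →
      ∃ ρ : ↥X →ₗ[S] ↥K, ρ.comp ι = LinearMap.id

/-- A left `S`-module `K` is *cotorsion* if `Ext¹_S(F, K) = 0` for every flat left
`S`-module `F`. -/
def IsCotorsion (K : ModuleCat.{u} S) : Prop :=
  ∀ F : ModuleCat.{u} S, IsFlatMod S F → Ext1Zero S F K

/-- `Tor₁^S(A, T) = 0` for a right `S`-module `A` and a left `S`-module `T`, expressed by its
standard characterization: for every short exact sequence `0 → K → F → T → 0` of left
`S`-modules with `F` flat, the induced map `A ⊗_S K → A ⊗_S F` is injective. -/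
def Tor1Zero (A : Type u) [AddCommGroup A] [Module Sᵐᵒᵖ A] (T : ModuleCat.{u} S) : Prop :=
  ∀ (K F : ModuleCat.{u} S) (ι : ↥K →ₗ[S] ↥F) (π : ↥F →ₗ[S] ↥T),
    IsFlatMod S F → Function.Injective ι → Function.Surjective π → Function.Exact ι π →
      Function.Injective (NTensor.rmap A ι)

/-- A left `S`-module is *finitely presented* if it admits a presentation with finitely many
generators and relations. -/
abbrev IsFinitelyPresented (M : ModuleCat.{u} S) : Prop :=
  Module.FinitePresentation S ↥M

end Dims

section CharacterModules

variable {S : Type u} [Ring S]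

/-- The character module of a right module is a left module. -/
instance CharacterModule.moduleOfRight (A : Type u) [AddCommGroup A] [Module Sᵐᵒᵖ A] :
    Module S (CharacterModule A) where
  smul r c := (c : A →+ AddCircle (1 : ℚ)).comp (DistribSMul.toAddMonoidHom A (op r))
  one_smul c := DFunLike.ext _ _ fun a => congrArg c (one_smul Sᵐᵒᵖ a)
  mul_smul r s c := DFunLike.ext _ _ fun a => congrArg c (mul_smul (op s) (op r) a)
  smul_zero _ := rfl
  smul_add _ _ _ := rfl
  add_smul r s c := DFunLike.ext _ _ fun a =>
    (congrArg c (add_smul (op r) (op s) a)).trans (map_add c _ _)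
  zero_smul c := DFunLike.ext _ _ fun a => (congrArg c (zero_smul Sᵐᵒᵖ a)).trans (map_zero c)

/-- The character module of a left module is a right module. -/
instance CharacterModule.moduleOfLeft (M : Type u) [AddCommGroup M] [Module S M] :
    Module Sᵐᵒᵖ (CharacterModule M) where
  smul r c := (c : M →+ AddCircle (1 : ℚ)).comp (DistribSMul.toAddMonoidHom M (unop r))
  one_smul c := DFunLike.ext _ _ fun a => congrArg c (one_smul S a)
  mul_smul r s c := DFunLike.ext _ _ fun a => congrArg c (mul_smul (unop s) (unop r) a)
  smul_zero _ := rfl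
  smul_add _ _ _ := rfl
  add_smul r s c := DFunLike.ext _ _ fun a =>
    (congrArg c (add_smul (unop r) (unop s) a)).trans (map_add c _ _)
  zero_smul c := DFunLike.ext _ _ fun a => (congrArg c (zero_smul S a)).trans (map_zero c)

variable {A B : Type u} [AddCommGroup A] [Module Sᵐᵒᵖ A] [AddCommGroup B] [Module Sᵐᵒᵖ B]
variable {M N P : Type u} [AddCommGroup M] [Module S M] [AddCommGroup N] [Module S N]
  [AddCommGroup P] [Module S P]

namespace CharacterModule

lemma left_smul_apply (r : S) (c : CharacterModule A) (a : A) : (r • c) a = c (op r • a) := rfl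

lemma right_smul_apply (r : Sᵐᵒᵖ) (c : CharacterModule M) (m : M) :
    (r • c) m = c (unop r • m) := rfl

lemma add_apply' {G : Type u} [AddCommGroup G] (c d : CharacterModule G) (x : G) :
    (c + d) x = c x + d x := rfl

/-- Swapping the arguments of a linear map into a character module. -/
def flip (φ : M →ₗ[S] CharacterModule A) : A →ₗ[Sᵐᵒᵖ] CharacterModule M where
  toFun a := AddMonoidHom.mk' (fun m => φ m a) fun m n => by rw [map_add, add_apply']
  map_add' a b := DFunLike.ext _ _ fun m => map_add (φ m) a b
  map_smul' r a := DFunLike.ext _ _ fun m => by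
    change φ m (r • a) = φ (unop r • m) a
    rw [LinearMap.map_smul φ, left_smul_apply, op_unop]

/-- Swapping the arguments of a linear map into a character module. -/
def flip' (φ : A →ₗ[Sᵐᵒᵖ] CharacterModule M) : M →ₗ[S] CharacterModule A where
  toFun m := AddMonoidHom.mk' (fun a => φ a m) fun m n => by rw [map_add, add_apply']
  map_add' a b := DFunLike.ext _ _ fun m => map_add (φ m) a b
  map_smul' r a := DFunLike.ext _ _ fun m => by
    change φ m (r • a) = φ (op r • m) a
    rw [LinearMap.map_smul φ, right_smul_apply, unop_op]

lemma flip_apply (φ : M →ₗ[S] CharacterModule A) (a : A) (m : M) : flip φ a m = φ m a := rfl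

lemma flip'_apply (φ : A →ₗ[Sᵐᵒᵖ] CharacterModule M) (a : A) (m : M) : flip' φ m a = φ a m := rfl

/-- The dual of a map of left modules. -/
def dualLeft (f : M →ₗ[S] N) : CharacterModule N →ₗ[Sᵐᵒᵖ] CharacterModule M where
  toFun c := AddMonoidHom.comp c f.toAddMonoidHom
  map_add' _ _ := rfl
  map_smul' r c := DFunLike.ext _ _ fun m => congrArg c (f.map_smul (unop r) m).symm

/-- The dual of a map of right modules. -/
def dualRight (f : A →ₗ[Sᵐᵒᵖ] B) : CharacterModule B →ₗ[S] CharacterModule A where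
  toFun c := AddMonoidHom.comp c f.toAddMonoidHom
  map_add' _ _ := rfl
  map_smul' r c := DFunLike.ext _ _ fun m => congrArg c (f.map_smul (op r) m).symm

lemma dualLeft_apply (f : M →ₗ[S] N) (c : CharacterModule N) (m : M) :
    dualLeft f c m = c (f m) := rfl

lemma dualRight_apply (f : A →ₗ[Sᵐᵒᵖ] B) (c : CharacterModule B) (a : A) :
    dualRight f c a = c (f a) := rfl

end CharacterModule

section AddGroups

variable {G H K : Type u} [AddCommGroup G] [AddCommGroup H] [AddCommGroup K]

lemma CharacterModule.exists_extension (f : G →+ H) (hf : Function.Injective f)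
    (c : CharacterModule G) : ∃ d : CharacterModule H, ∀ x, d (f x) = c x := by
  obtain ⟨d, hd⟩ := CharacterModule.dual_surjective_of_injective f.toIntLinearMap hf c
  exact ⟨d, fun x => DFunLike.congr_fun hd x⟩

lemma CharacterModule.exists_extension_of_exact (f : G →+ H) (g : H →+ K)
    (hfg : Function.Exact f g) (c : CharacterModule H) (hc : ∀ x, c (f x) = 0) :
    ∃ d : CharacterModule K, ∀ x, d (g x) = c x := by
  have hker : g.ker ≤ AddMonoidHom.ker (c : H →+ AddCircle (1 : ℚ)) := fun x hx => by
    obtain ⟨y, rfl⟩ := (hfg x).1 hx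
    exact hc y
  obtain ⟨d, hd⟩ := exists_extension (QuotientAddGroup.kerLift g)
    (QuotientAddGroup.kerLift_injective g) (QuotientAddGroup.lift g.ker c hker)
  exact ⟨d, fun x => hd (QuotientAddGroup.mk x)⟩

lemma AddMonoidHom.injective_iff_character_extension (f : G →+ H) :
    Function.Injective f ↔
      ∀ c : CharacterModule G, ∃ d : CharacterModule H, ∀ x, d (f x) = c x := by
  refine ⟨CharacterModule.exists_extension f, fun h => (injective_iff_map_eq_zero f).2 fun x hx =>
    CharacterModule.eq_zero_of_character_apply fun c => ?_⟩
  obtain ⟨d, hd⟩ := h c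
  rw [← hd, hx, map_zero]

lemma AddMonoidHom.exact_iff_character_extension (f : G →+ H) (g : H →+ K)
    (hgf : ∀ x, g (f x) = 0) :
    Function.Exact f g ↔ ∀ c : CharacterModule H, (∀ x, c (f x) = 0) →
      ∃ d : CharacterModule K, ∀ x, d (g x) = c x := by
  refine ⟨CharacterModule.exists_extension_of_exact f g, fun h x => ⟨fun hx => ?_, ?_⟩⟩
  · rw [← AddMonoidHom.coe_range f, SetLike.mem_coe, ← QuotientAddGroup.eq_zero_iff]
    refine CharacterModule.eq_zero_of_character_apply fun c => ?_
    obtain ⟨d, hd⟩ := h (AddMonoidHom.comp c (QuotientAddGroup.mk' f.range)) fun y => by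
      change c (QuotientAddGroup.mk (f y)) = 0
      rw [(QuotientAddGroup.eq_zero_iff (f y)).2 (AddMonoidHom.mem_range.2 ⟨y, rfl⟩), map_zero]
    exact (hd x).symm.trans (by rw [hx, map_zero])
  · rintro ⟨y, rfl⟩
    exact hgf y

end AddGroups

namespace NTensor

/-- The pure tensor `a ⊗ m`. -/
def tmul (a : A) (m : M) : NTensor S A M := QuotientAddGroup.mk (FreeAbelianGroup.of (a, m))

lemma addHom_ext {G : Type*} [AddCommGroup G] {f g : NTensor S A M →+ G}
    (h : ∀ a m, f (tmul a m) = g (tmul a m)) : f = g := by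
  refine QuotientAddGroup.addMonoidHom_ext _ (FreeAbelianGroup.lift_ext _ _ fun x => h x.1 x.2)

lemma lmap_tmul (f : A →ₗ[Sᵐᵒᵖ] B) (a : A) (m : M) : lmap M f (tmul a m) = tmul (f a) m := by
  change QuotientAddGroup.mk (FreeAbelianGroup.map _ _) = _
  rw [FreeAbelianGroup.map_of_apply]
  rfl

lemma rmap_tmul (f : M →ₗ[S] N) (a : A) (m : M) : rmap A f (tmul a m) = tmul a (f m) := by
  change QuotientAddGroup.mk (FreeAbelianGroup.map _ _) = _
  rw [FreeAbelianGroup.map_of_apply]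
  rfl

lemma mk_eq_zero_of_mem {x : FreeAbelianGroup (A × M)} (hx : x ∈ tensorRels S A M) :
    (QuotientAddGroup.mk x : FreeAbelianGroup (A × M) ⧸ tensorRels S A M) = 0 :=
  (QuotientAddGroup.eq_zero_iff x).2 hx

lemma add_tmul (a b : A) (m : M) : (tmul (a + b) m : NTensor S A M) = tmul a m + tmul b m := by
  have := mk_eq_zero_of_mem (S := S) (AddSubgroup.subset_closure (Or.inl ⟨a, b, m, rfl⟩))
  exact sub_eq_zero.1 ((sub_sub _ _ _).symm.trans this)

lemma tmul_add (a : A) (m n : M) : (tmul a (m + n) : NTensor S A M) = tmul a m + tmul a n := by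
  have := mk_eq_zero_of_mem (S := S) (AddSubgroup.subset_closure (Or.inr (Or.inl ⟨a, m, n, rfl⟩)))
  exact sub_eq_zero.1 ((sub_sub _ _ _).symm.trans this)

lemma smul_tmul (a : A) (r : S) (m : M) :
    (tmul (op r • a) m : NTensor S A M) = tmul a (r • m) := by
  have := mk_eq_zero_of_mem (S := S) (AddSubgroup.subset_closure (Or.inr (Or.inr ⟨a, r, m, rfl⟩)))
  exact sub_eq_zero.1 this

/-- The character of `A ⊗ M` induced by a linear map from `M` to the character module of `A`. -/
def ofHom (φ : M →ₗ[S] CharacterModule A) : CharacterModule (NTensor S A M) :=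
  QuotientAddGroup.lift (tensorRels S A M) (FreeAbelianGroup.lift fun x => φ x.2 x.1) (by
    refine (AddSubgroup.closure_le _).2 ?_
    rintro x (⟨a₁, a₂, m, rfl⟩ | ⟨a, m₁, m₂, rfl⟩ | ⟨a, r, m, rfl⟩) <;>
      simp [CharacterModule.add_apply', CharacterModule.left_smul_apply])

lemma ofHom_tmul (φ : M →ₗ[S] CharacterModule A) (a : A) (m : M) :
    ofHom φ (tmul a m) = φ m a :=
  FreeAbelianGroup.lift_apply_of _ _

/-- The linear map from `M` to the character module of `A` given by a character of `A ⊗ M`. -/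
def toHom (c : CharacterModule (NTensor S A M)) : M →ₗ[S] CharacterModule A where
  toFun m := AddMonoidHom.mk' (fun a => c (tmul a m)) fun a b => by rw [add_tmul, map_add]
  map_add' m n := DFunLike.ext _ _ fun a =>
    (congrArg c (tmul_add a m n)).trans (map_add c _ _)
  map_smul' r m := DFunLike.ext _ _ fun a => congrArg c (smul_tmul a r m).symm

lemma toHom_apply (c : CharacterModule (NTensor S A M)) (m : M) (a : A) :
    toHom c m a = c (tmul a m) := rfl

lemma rmap_exact_iff (f : M →ₗ[S] N) (g : N →ₗ[S] P) (hgf : ∀ x, g (f x) = 0) :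
    Function.Exact (rmap A f) (rmap A g) ↔
      ∀ χ : N →ₗ[S] CharacterModule A, (∀ x, χ (f x) = 0) →
        ∃ ψ : P →ₗ[S] CharacterModule A, ∀ x, ψ (g x) = χ x := by
  rw [AddMonoidHom.exact_iff_character_extension]
  · constructor
    · intro h χ hχ
      obtain ⟨d, hd⟩ := h (ofHom χ) fun x => by
        have : AddMonoidHom.comp (ofHom χ) (rmap A f) = 0 := addHom_ext fun a m => by
          change ofHom χ (rmap A f (tmul a m)) = 0
          rw [rmap_tmul, ofHom_tmul, hχ]
          rfl
        exact DFunLike.congr_fun this x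
      refine ⟨toHom d, fun x => DFunLike.ext _ _ fun a => ?_⟩
      rw [toHom_apply, ← rmap_tmul, hd, ofHom_tmul]
    · intro h c hc
      obtain ⟨ψ, hψ⟩ := h (toHom c) fun x => DFunLike.ext _ _ fun a => by
        rw [toHom_apply, ← rmap_tmul, hc]
        rfl
      refine ⟨ofHom ψ, fun x => ?_⟩
      have : AddMonoidHom.comp (ofHom ψ) (rmap A g) = c := addHom_ext fun a m => by
        change ofHom ψ (rmap A g (tmul a m)) = c _
        rw [rmap_tmul, ofHom_tmul, hψ, toHom_apply]
      exact DFunLike.congr_fun this x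
  · intro x
    have : (rmap A g).comp (rmap A f) = 0 := addHom_ext fun a m => by
      change rmap A g (rmap A f (tmul a m)) = 0
      rw [rmap_tmul, rmap_tmul, hgf]
      simpa using tmul_add (S := S) a (0 : P) 0
    exact DFunLike.congr_fun this x

lemma lmap_injective_iff (f : A →ₗ[Sᵐᵒᵖ] B) :
    Function.Injective (lmap M f) ↔
      ∀ χ : A →ₗ[Sᵐᵒᵖ] CharacterModule M, ∃ ψ : B →ₗ[Sᵐᵒᵖ] CharacterModule M,
        ∀ a, ψ (f a) = χ a := by
  rw [AddMonoidHom.injective_iff_character_extension]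
  constructor
  · intro h χ
    obtain ⟨d, hd⟩ := h (ofHom (CharacterModule.flip' χ))
    refine ⟨CharacterModule.flip (toHom d), fun a => DFunLike.ext _ _ fun m => ?_⟩
    rw [CharacterModule.flip_apply, toHom_apply, ← lmap_tmul, hd, ofHom_tmul,
      CharacterModule.flip'_apply]
  · intro h c
    obtain ⟨ψ, hψ⟩ := h (CharacterModule.flip (toHom c))
    refine ⟨ofHom (CharacterModule.flip' ψ), fun x => ?_⟩
    have : AddMonoidHom.comp (ofHom (CharacterModule.flip' ψ)) (lmap M f) = c :=
      addHom_ext fun a m => by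
        change ofHom _ (lmap M f (tmul a m)) = c _
        rw [lmap_tmul, ofHom_tmul, CharacterModule.flip'_apply, hψ, CharacterModule.flip_apply,
          toHom_apply]
    exact DFunLike.congr_fun this x

end NTensor

lemma isFlatMod_iff_injective_character (F : ModuleCat.{u} S) :
    IsFlatMod S F ↔ Module.Injective Sᵐᵒᵖ (CharacterModule F) := by
  constructor
  · intro h
    exact ⟨fun X Y _ _ _ _ f hf g => (NTensor.lmap_injective_iff f).1 (h X Y f hf) g⟩
  · intro h A B _ _ _ _ f hf
    exact (NTensor.lmap_injective_iff f).2 fun χ => h.out f hf χ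

lemma Module.Injective.of_ringEquiv_smul {T : Type u} [Ring T] (e : S ≃+* T) (X : Type u)
    [AddCommGroup X] [Module S X] [Module T X] (he : ∀ (s : S) (x : X), e s • x = s • x)
    (h : Module.Injective S X) : Module.Injective T X := by
  refine ⟨fun Y Z _ _ _ _ f hf g => ?_⟩
  let := Module.compHom Y e.toRingHom
  let := Module.compHom Z e.toRingHom
  let f' : Y →ₗ[S] Z :=
    { toFun := f, map_add' := map_add f, map_smul' := fun s y => f.map_smul (e s) y }
  let g' : Y →ₗ[S] X :=
    { toFun := g, map_add' := map_add g,
      map_smul' := fun s y => (g.map_smul (e s) y).trans (he _ _) }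
  obtain ⟨k, hk⟩ := h.out f' hf g'
  refine ⟨{ toFun := k, map_add' := map_add k, map_smul' := fun t y => ?_ }, hk⟩
  have := k.map_smul (e.symm t) y
  rw [← he, e.apply_symm_apply] at this
  rw [RingHom.id_apply, ← this]
  congr 1
  change t • y = e (e.symm t) • y
  rw [e.apply_symm_apply]

/-- A right module is flat iff its character module is injective as a left module. -/
lemma isFlatMod_op_iff_injective_character (F : ModuleCat.{u} Sᵐᵒᵖ) :
    IsFlatMod Sᵐᵒᵖ F ↔ Module.Injective S (CharacterModule F) := by
  rw [isFlatMod_iff_injective_character]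
  exact ⟨.of_ringEquiv_smul (RingEquiv.opOp S).symm _ fun _ _ => rfl,
    .of_ringEquiv_smul (RingEquiv.opOp S) _ fun _ _ => rfl⟩

lemma injective_character_of_projective (Q : Type u) [AddCommGroup Q] [Module Sᵐᵒᵖ Q]
    [Module.Projective Sᵐᵒᵖ Q] : Module.Injective S (CharacterModule Q) := by
  refine ⟨fun X Y _ _ _ _ f hf g => ?_⟩
  have hsurj : Function.Surjective (CharacterModule.dualLeft f) := fun c => by
    obtain ⟨d, hd⟩ := CharacterModule.exists_extension f.toAddMonoidHom hf c
    exact ⟨d, DFunLike.ext _ _ hd⟩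
  obtain ⟨k, hk⟩ := Module.projective_lifting_property _ (CharacterModule.flip g) hsurj
  refine ⟨CharacterModule.flip' k, fun x => DFunLike.ext _ _ fun q => ?_⟩
  exact DFunLike.congr_fun (LinearMap.congr_fun hk q) x

lemma isFlatMod_of_projective (Q : ModuleCat.{u} S) [Module.Projective S Q] : IsFlatMod S Q := by
  rw [isFlatMod_iff_injective_character]
  refine ⟨fun X Y _ _ _ _ f hf g => ?_⟩
  have hsurj : Function.Surjective (CharacterModule.dualRight f) := fun c => by
    obtain ⟨d, hd⟩ := CharacterModule.exists_extension f.toAddMonoidHom hf c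
    exact ⟨d, DFunLike.ext _ _ hd⟩
  obtain ⟨k, hk⟩ := Module.projective_lifting_property _ (CharacterModule.flip' g) hsurj
  refine ⟨CharacterModule.flip k, fun x => DFunLike.ext _ _ fun q => ?_⟩
  exact DFunLike.congr_fun (LinearMap.congr_fun hk q) x

end CharacterModules

section ShortExactSequences

variable {S : Type u} [Ring S]

/-- A short exact sequence `0 → A → B → C → 0` of modules. -/
structure IsShortExact {A B C : Type u} [AddCommGroup A] [AddCommGroup B] [AddCommGroup C]
    [Module S A] [Module S B] [Module S C] (f : A →ₗ[S] B) (g : B →ₗ[S] C) : Prop where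
  injective : Function.Injective f
  surjective : Function.Surjective g
  exact : Function.Exact f g

lemma isShortExact_ker {A B : Type u} [AddCommGroup A] [AddCommGroup B]
    [Module S A] [Module S B] (g : A →ₗ[S] B) (hg : Function.Surjective g) :
    IsShortExact (LinearMap.ker g).subtype g :=
  ⟨Subtype.val_injective, hg, fun x => by simp⟩

lemma exists_projective_presentation (M : ModuleCat.{u} S) :
    ∃ (K P : ModuleCat.{u} S) (f : K →ₗ[S] P) (g : P →ₗ[S] M),
      IsShortExact f g ∧ Module.Projective S P :=
  ⟨ModuleCat.of S (LinearMap.ker (Finsupp.linearCombination S (id : M → M))),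
    ModuleCat.of S (M →₀ S), (LinearMap.ker (Finsupp.linearCombination S (id : M → M))).subtype,
    Finsupp.linearCombination S (id : M → M),
    isShortExact_ker _ (Finsupp.linearCombination_id_surjective S M),
    inferInstanceAs (Module.Projective S (M →₀ S))⟩

namespace IsShortExact

variable {A B C : Type u} [AddCommGroup A] [AddCommGroup B] [AddCommGroup C]
  [Module S A] [Module S B] [Module S C] {f : A →ₗ[S] B} {g : B →ₗ[S] C}

lemma apply_apply_eq_zero (h : IsShortExact f g) (a : A) : g (f a) = 0 :=
  h.exact.apply_apply_eq_zero a

lemma exists_lift (h : IsShortExact f g) {X : Type u} [AddCommGroup X] [Module S X] (k : B →ₗ[S] X)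
    (hk : ∀ a, k (f a) = 0) : ∃ l : C →ₗ[S] X, ∀ b, l (g b) = k b := by
  have hker : LinearMap.ker g ≤ LinearMap.ker k := fun x hx => by
    obtain ⟨y, rfl⟩ := (h.exact x).1 hx
    exact hk y
  refine ⟨((LinearMap.ker g).liftQ k hker).comp
    (g.quotKerEquivOfSurjective h.surjective).symm.toLinearMap, fun b => ?_⟩
  have : (g.quotKerEquivOfSurjective h.surjective).symm (g b) = (LinearMap.ker g).mkQ b :=
    (LinearEquiv.symm_apply_eq _).2 rfl
  rw [LinearMap.comp_apply, LinearEquiv.coe_coe, this]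
  rfl

lemma dualLeft (h : IsShortExact f g) :
    IsShortExact (CharacterModule.dualLeft g) (CharacterModule.dualLeft f) where
  injective c d hcd := DFunLike.ext _ _ fun x => by
    obtain ⟨y, rfl⟩ := h.surjective x
    exact DFunLike.congr_fun hcd y
  surjective c := by
    obtain ⟨d, hd⟩ := CharacterModule.exists_extension f.toAddMonoidHom h.injective c
    exact ⟨d, DFunLike.ext _ _ hd⟩
  exact c := by
    constructor
    · intro hc
      obtain ⟨d, hd⟩ := CharacterModule.exists_extension_of_exact f.toAddMonoidHom g.toAddMonoidHom
        h.exact c fun x => DFunLike.congr_fun hc x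
      exact ⟨d, DFunLike.ext _ _ hd⟩
    · rintro ⟨d, rfl⟩
      refine DFunLike.ext _ _ fun x => ?_
      rw [CharacterModule.dualLeft_apply, CharacterModule.dualLeft_apply, h.apply_apply_eq_zero,
        map_zero]
      rfl

end IsShortExact

lemma IsShortExact.dualRight {A B C : Type u} [AddCommGroup A] [AddCommGroup B] [AddCommGroup C]
    [Module Sᵐᵒᵖ A] [Module Sᵐᵒᵖ B] [Module Sᵐᵒᵖ C] {f : A →ₗ[Sᵐᵒᵖ] B} {g : B →ₗ[Sᵐᵒᵖ] C}
    (h : IsShortExact f g) :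
    IsShortExact (CharacterModule.dualRight g) (CharacterModule.dualRight f) where
  injective c d hcd := DFunLike.ext _ _ fun x => by
    obtain ⟨y, rfl⟩ := h.surjective x
    exact DFunLike.congr_fun hcd y
  surjective c := by
    obtain ⟨d, hd⟩ := CharacterModule.exists_extension f.toAddMonoidHom h.injective c
    exact ⟨d, DFunLike.ext _ _ hd⟩
  exact c := by
    constructor
    · intro hc
      obtain ⟨d, hd⟩ := CharacterModule.exists_extension_of_exact f.toAddMonoidHom g.toAddMonoidHom
        h.exact c fun x => DFunLike.congr_fun hc x
      exact ⟨d, DFunLike.ext _ _ hd⟩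
    · rintro ⟨d, rfl⟩
      refine DFunLike.ext _ _ fun x => ?_
      rw [CharacterModule.dualRight_apply, CharacterModule.dualRight_apply, h.apply_apply_eq_zero,
        map_zero]
      rfl

/-- Pushing out `A → B → C` along `A → B'`, the latter being part of `A → B' → C'`. -/
lemma IsShortExact.exists_pushout {A B C B' C' : ModuleCat.{u} S} {f : A →ₗ[S] B} {g : B →ₗ[S] C}
    {f' : A →ₗ[S] B'} {g' : B' →ₗ[S] C'} (h : IsShortExact f g) (h' : IsShortExact f' g') :
    ∃ (D : ModuleCat.{u} S) (i : B →ₗ[S] D) (p : D →ₗ[S] C') (i' : B' →ₗ[S] D) (p' : D →ₗ[S] C),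
      IsShortExact i p ∧ IsShortExact i' p' := by
  let U : Submodule S (B × B') := LinearMap.range (f.prod (-f'))
  have hU : ∀ b b', ((b, b') : B × B') ∈ U ↔ ∃ a, f a = b ∧ - f' a = b' := fun b b' => by
    simp [U, LinearMap.mem_range]
  let p : (B × B') ⧸ U →ₗ[S] C' := U.liftQ (g'.comp (LinearMap.snd S B B')) (by
    rintro _ ⟨a, rfl⟩
    simp [h'.apply_apply_eq_zero])
  let p' : (B × B') ⧸ U →ₗ[S] C := U.liftQ (g.comp (LinearMap.fst S B B')) (by
    rintro _ ⟨a, rfl⟩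
    simp [h.apply_apply_eq_zero])
  have hp : ∀ b b', p (U.mkQ (b, b')) = g' b' := fun _ _ => rfl
  have hp' : ∀ b b', p' (U.mkQ (b, b')) = g b := fun _ _ => rfl
  refine ⟨ModuleCat.of S ((B × B') ⧸ U), U.mkQ.comp (LinearMap.inl S B B'), p,
    U.mkQ.comp (LinearMap.inr S B B'), p', ⟨?_, ?_, ?_⟩, ⟨?_, ?_, ?_⟩⟩
  · refine (injective_iff_map_eq_zero _).2 fun b hb => ?_
    obtain ⟨a, rfl, ha⟩ := (hU b 0).1 ((Submodule.Quotient.mk_eq_zero U).1 hb)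
    rw [h'.injective ((neg_eq_zero.1 ha).trans (map_zero f').symm), map_zero]
  · intro c
    obtain ⟨b', rfl⟩ := h'.surjective c
    exact ⟨U.mkQ (0, b'), rfl⟩
  · intro x
    obtain ⟨⟨b, b'⟩, rfl⟩ := U.mkQ_surjective x
    rw [hp, h'.exact b']
    constructor
    · rintro ⟨a, rfl⟩
      refine ⟨b + f a, (Submodule.Quotient.eq U).2 ((hU _ _).2 ⟨a, ?_, ?_⟩)⟩ <;> simp
    · rintro ⟨c, hc⟩
      obtain ⟨a, -, ha⟩ := (hU (c - b) (0 - b')).1 ((Submodule.Quotient.eq U).1 hc)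
      exact ⟨a, by simpa using ha⟩
  · refine (injective_iff_map_eq_zero _).2 fun b hb => ?_
    obtain ⟨a, ha, rfl⟩ := (hU 0 b).1 ((Submodule.Quotient.mk_eq_zero U).1 hb)
    rw [h.injective (ha.trans (map_zero f).symm), map_zero, neg_zero]
  · intro c
    obtain ⟨b, rfl⟩ := h.surjective c
    exact ⟨U.mkQ (b, 0), rfl⟩
  · intro x
    obtain ⟨⟨b, b'⟩, rfl⟩ := U.mkQ_surjective x
    rw [hp', h.exact b]
    constructor
    · rintro ⟨a, rfl⟩
      refine ⟨b' + f' a, (Submodule.Quotient.eq U).2 ((hU _ _).2 ⟨-a, ?_, ?_⟩)⟩ <;> simp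
    · rintro ⟨c, hc⟩
      obtain ⟨a, ha, -⟩ := (hU (0 - b) (c - b')).1 ((Submodule.Quotient.eq U).1 hc)
      exact ⟨-a, by simp [ha]⟩

/-- For submodules `A ⊆ B ⊆ D`, the quotient `D / A` is an extension of `D / B` by `B / A`. -/
lemma IsShortExact.exists_quotient {A B C D E : ModuleCat.{u} S} {f : A →ₗ[S] B} {g : B →ₗ[S] C}
    {i : B →ₗ[S] D} {p : D →ₗ[S] E} (h : IsShortExact f g) (h' : IsShortExact i p) :
    ∃ (Q : ModuleCat.{u} S) (q : D →ₗ[S] Q) (j : C →ₗ[S] Q) (k : Q →ₗ[S] E),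
      IsShortExact (i.comp f) q ∧ IsShortExact j k := by
  let U : Submodule S D := LinearMap.range (i.comp f)
  have hq : IsShortExact (i.comp f) U.mkQ :=
    ⟨h'.injective.comp h.injective, U.mkQ_surjective, fun x => by
      rw [Submodule.mkQ_apply, Submodule.Quotient.mk_eq_zero]; rfl⟩
  obtain ⟨j, hj⟩ := h.exists_lift (U.mkQ.comp i) fun a =>
    (Submodule.Quotient.mk_eq_zero U).2 ⟨a, rfl⟩
  let k : D ⧸ U →ₗ[S] E := U.liftQ p (by
    rintro _ ⟨a, rfl⟩
    simp [h'.apply_apply_eq_zero])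
  have hk : ∀ d, k (U.mkQ d) = p d := fun _ => rfl
  refine ⟨ModuleCat.of S (D ⧸ U), U.mkQ, j, k, hq, ⟨?_, ?_, ?_⟩⟩
  · refine (injective_iff_map_eq_zero _).2 fun c hc => ?_
    obtain ⟨b, rfl⟩ := h.surjective c
    rw [hj] at hc
    obtain ⟨a, ha⟩ := (Submodule.Quotient.mk_eq_zero U).1 hc
    rw [← h'.injective ha, h.apply_apply_eq_zero]
  · intro e
    obtain ⟨d, rfl⟩ := h'.surjective e
    exact ⟨U.mkQ d, rfl⟩
  · intro x
    obtain ⟨d, rfl⟩ := U.mkQ_surjective x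
    rw [hk, h'.exact d]
    constructor
    · rintro ⟨b, rfl⟩
      exact ⟨g b, hj b⟩
    · rintro ⟨c, hc⟩
      obtain ⟨b, rfl⟩ := h.surjective c
      rw [hj] at hc
      obtain ⟨a, ha⟩ := (Submodule.Quotient.eq U).1 hc
      exact ⟨b - f a, by rw [map_sub, ← LinearMap.comp_apply, ha]; abel⟩

end ShortExactSequences

section ExtVanishing

open CategoryTheory Abelian

variable {S : Type u} [Ring S]

/-- The vanishing of `Extⁱ(M, X)`. -/
def ExtVanishes (i : ℕ) (M X : ModuleCat.{u} S) : Prop := Subsingleton (Ext.{u} M X i)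

lemma ExtVanishes.of_forall_eq_zero {i : ℕ} {M X : ModuleCat.{u} S}
    (h : ∀ x : Ext.{u} M X i, x = 0) : ExtVanishes i M X :=
  ⟨fun a b => (h a).trans (h b).symm⟩

lemma ExtVanishes.eq_zero {i : ℕ} {M X : ModuleCat.{u} S} (h : ExtVanishes i M X)
    (x : Ext.{u} M X i) : x = 0 :=
  Subsingleton.elim (h := h) x 0

lemma extVanishes_of_projective (i : ℕ) (M X : ModuleCat.{u} S) [Module.Projective S M] :
    ExtVanishes (i + 1) M X :=
  have : Projective M := (IsProjective.iff_projective M).1 inferInstance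
  Ext.subsingleton_of_projective M X i

lemma extVanishes_of_injective (i : ℕ) (M X : ModuleCat.{u} S) (hX : Module.Injective S X) :
    ExtVanishes (i + 1) M X :=
  have : Injective X := Module.injective_object_of_injective_module S X
  Ext.subsingleton_of_injective M X i

lemma injective_of_extVanishes_one (X : ModuleCat.{u} S) (h : ∀ M, ExtVanishes 1 M X) :
    Module.Injective S X :=
  have : Injective X := injective_iff_subsingleton_ext_one.2 fun M => h M
  Module.injective_module_of_injective_object S X

namespace IsShortExact

variable {A B C : ModuleCat.{u} S} {f : A →ₗ[S] B} {g : B →ₗ[S] C}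

lemma shortExact (h : IsShortExact f g) :
    (ShortComplex.mk (ModuleCat.ofHom f) (ModuleCat.ofHom g) (by
      ext x; exact h.apply_apply_eq_zero x)).ShortExact :=
  ModuleCat.shortComplex_shortExact _ h.exact h.injective h.surjective

lemma extVanishes_left (h : IsShortExact f g) {i : ℕ} {X : ModuleCat.{u} S} (hB : ExtVanishes i B X)
    (hC : ExtVanishes (i + 1) C X) : ExtVanishes i A X :=
  .of_forall_eq_zero fun x => by
    obtain ⟨y, rfl⟩ := Ext.contravariant_sequence_exact₁ h.shortExact X x (add_comm 1 i)
      (hC.eq_zero _)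
    rw [hB.eq_zero y, Ext.comp_zero]

lemma extVanishes_middle (h : IsShortExact f g)
    {i : ℕ} {X : ModuleCat.{u} S} (hA : ExtVanishes i A X)
    (hC : ExtVanishes i C X) : ExtVanishes i B X :=
  .of_forall_eq_zero fun x => by
    obtain ⟨y, rfl⟩ := Ext.contravariant_sequence_exact₂ h.shortExact X x (hA.eq_zero _)
    rw [hC.eq_zero y, Ext.comp_zero]

lemma extVanishes_right (h : IsShortExact f g)
    {i : ℕ} {X : ModuleCat.{u} S} (hA : ExtVanishes i A X)
    (hB : ExtVanishes (i + 1) B X) : ExtVanishes (i + 1) C X :=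
  .of_forall_eq_zero fun x => by
    obtain ⟨y, rfl⟩ := Ext.contravariant_sequence_exact₃ h.shortExact X x (hB.eq_zero _)
      (add_comm 1 i)
    rw [hA.eq_zero y, Ext.comp_zero]

lemma extVanishes_target_right (h : IsShortExact f g)
    {i : ℕ} {M : ModuleCat.{u} S} (hB : ExtVanishes i M B)
    (hA : ExtVanishes (i + 1) M A) : ExtVanishes i M C :=
  .of_forall_eq_zero fun x => by
    obtain ⟨y, rfl⟩ := Ext.covariant_sequence_exact₃ M h.shortExact x rfl (hA.eq_zero _)
    rw [hB.eq_zero y, Ext.zero_comp]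

lemma extVanishes_target_left (h : IsShortExact f g)
    {i : ℕ} {M : ModuleCat.{u} S} (hB : ExtVanishes (i + 1) M B)
    (hC : ExtVanishes i M C) : ExtVanishes (i + 1) M A :=
  .of_forall_eq_zero fun x => by
    obtain ⟨y, rfl⟩ := Ext.covariant_sequence_exact₁ M h.shortExact x (hB.eq_zero _) rfl
    rw [hC.eq_zero y, Ext.zero_comp]

lemma exists_extension (h : IsShortExact f g)
    {X : ModuleCat.{u} S} (hC : ExtVanishes 1 C X) (φ : A →ₗ[S] X) :
    ∃ ψ : B →ₗ[S] X, ∀ a, ψ (f a) = φ a := by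
  obtain ⟨y, hy⟩ := Ext.contravariant_sequence_exact₁ h.shortExact X
    (Ext.mk₀ (ModuleCat.ofHom φ)) (add_zero 1) (hC.eq_zero _)
  obtain ⟨ψ, rfl⟩ := Ext.addEquiv₀.symm.surjective y
  rw [Ext.addEquiv₀_symm_apply, Ext.mk₀_comp_mk₀] at hy
  have := (Ext.mk₀_bijective _ _).1 hy
  exact ⟨ψ.hom, fun a => ConcreteCategory.congr_hom this a⟩

lemma extVanishes_one (h : IsShortExact f g) {X : ModuleCat.{u} S} (hB : ExtVanishes 1 B X)
    (hext : ∀ φ : A →ₗ[S] X, ∃ ψ : B →ₗ[S] X, ∀ a, ψ (f a) = φ a) : ExtVanishes 1 C X :=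
  .of_forall_eq_zero fun x => by
    obtain ⟨y, rfl⟩ := Ext.contravariant_sequence_exact₃ h.shortExact X x (hB.eq_zero _)
      (add_zero 1)
    obtain ⟨φ, rfl⟩ := Ext.addEquiv₀.symm.surjective y
    obtain ⟨ψ, hψ⟩ := hext φ.hom
    have : φ = ModuleCat.ofHom f ≫ ModuleCat.ofHom ψ := by
      ext a
      exact (hψ a).symm
    rw [Ext.addEquiv₀_symm_apply, this, ← Ext.mk₀_comp_mk₀]
    exact h.shortExact.extClass_comp_assoc _

end IsShortExact

end ExtVanishing

section GorensteinFlat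

variable {S : Type u} [Ring S]

lemma Module.Injective.of_retract {X Y : Type u} [AddCommGroup X] [AddCommGroup Y] [Module S X]
    [Module S Y] (s : X →ₗ[S] Y) (r : Y →ₗ[S] X) (hrs : r ∘ₗ s = LinearMap.id)
    (hY : Module.Injective S Y) : Module.Injective S X := by
  refine ⟨fun A B _ _ _ _ f hf g => ?_⟩
  obtain ⟨k, hk⟩ := hY.out f hf (s ∘ₗ g)
  exact ⟨r ∘ₗ k, fun x => by
    rw [LinearMap.comp_apply, hk, LinearMap.comp_apply, ← LinearMap.comp_apply, hrs,
      LinearMap.id_apply]⟩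

/-- The character module of a right module, as an object of the category of left modules. -/
abbrev characterCat (A : ModuleCat.{u} Sᵐᵒᵖ) : ModuleCat.{u} S := ModuleCat.of S (CharacterModule A)

namespace IsShortExact

variable {A B C : ModuleCat.{u} S} {f : A →ₗ[S] B} {g : B →ₗ[S] C}

lemma section_dualLeft_iff_retraction_dualLeft (h : IsShortExact f g) :
    (∃ s, CharacterModule.dualLeft f ∘ₗ s = LinearMap.id) ↔
      ∃ r, r ∘ₗ CharacterModule.dualLeft g = LinearMap.id :=
  (h.dualLeft.exact.split_tfae h.dualLeft.injective h.dualLeft.surjective).out 0 1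

lemma exists_section_dualLeft (h : IsShortExact f g) (hC : IsFlatMod S C) :
    ∃ s : CharacterModule A →ₗ[Sᵐᵒᵖ] CharacterModule B,
      CharacterModule.dualLeft f ∘ₗ s = LinearMap.id := by
  rw [isFlatMod_iff_injective_character] at hC
  obtain ⟨r, hr⟩ := hC.out _ h.dualLeft.injective LinearMap.id
  exact h.section_dualLeft_iff_retraction_dualLeft.2 ⟨r, LinearMap.ext hr⟩

lemma isFlatMod_left (h : IsShortExact f g) (hB : IsFlatMod S B) (hC : IsFlatMod S C) :
    IsFlatMod S A := by
  obtain ⟨s, hs⟩ := h.exists_section_dualLeft hC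
  rw [isFlatMod_iff_injective_character] at hB ⊢
  exact .of_retract s _ hs hB

lemma isFlatMod_right (h : IsShortExact f g) (hB : IsFlatMod S B)
    (hC : ExtVanishes 1 C (characterCat (ModuleCat.of Sᵐᵒᵖ (CharacterModule A)))) :
    IsFlatMod S C := by
  obtain ⟨ψ, hψ⟩ := h.exists_extension hC (CharacterModule.flip' LinearMap.id)
  have hs : CharacterModule.dualLeft f ∘ₗ CharacterModule.flip ψ = LinearMap.id :=
    LinearMap.ext fun c => DFunLike.ext _ _ fun x => by
      change ψ (f x) c = c x
      rw [hψ]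
      rfl
  obtain ⟨r, hr⟩ := h.section_dualLeft_iff_retraction_dualLeft.1 ⟨_, hs⟩
  rw [isFlatMod_iff_injective_character] at hB ⊢
  exact .of_retract _ r hr hB

end IsShortExact

lemma IsFlatMod.extVanishes {F : ModuleCat.{u} S} (hF : IsFlatMod S F) (A : ModuleCat.{u} Sᵐᵒᵖ)
    (i : ℕ) : ExtVanishes (i + 1) F (characterCat A) := by
  induction i generalizing F with
  | zero =>
    obtain ⟨K, P, f, g, h, hP⟩ := exists_projective_presentation F
    obtain ⟨s, hs⟩ := h.exists_section_dualLeft hF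
    refine h.extVanishes_one (extVanishes_of_projective 0 P _) fun φ =>
      ⟨CharacterModule.flip' (s ∘ₗ CharacterModule.flip φ), fun k => DFunLike.ext _ _ fun a => ?_⟩
    exact DFunLike.congr_fun (LinearMap.congr_fun hs (CharacterModule.flip φ a)) k
  | succ i ih =>
    obtain ⟨K, P, f, g, h, hP⟩ := exists_projective_presentation F
    exact h.extVanishes_right (ih (h.isFlatMod_left (isFlatMod_of_projective P) hF))
      (extVanishes_of_projective _ P _)

/-- The vanishing of `Torᵢ(I, M)`, expressed by `Extⁱ(M, I⁺)`, for all `i > 0` and all injective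
right modules `I`. -/
def IsTorAcyclic (M : ModuleCat.{u} S) : Prop :=
  ∀ I : ModuleCat.{u} Sᵐᵒᵖ, Module.Injective Sᵐᵒᵖ I → ∀ i, ExtVanishes (i + 1) M (characterCat I)

lemma IsFlatMod.isTorAcyclic {F : ModuleCat.{u} S} (hF : IsFlatMod S F) : IsTorAcyclic F :=
  fun I _ i => hF.extVanishes I i

lemma IsShortExact.isTorAcyclic_left {A B C : ModuleCat.{u} S} {f : A →ₗ[S] B} {g : B →ₗ[S] C}
    (h : IsShortExact f g) (hB : IsTorAcyclic B) (hC : IsTorAcyclic C) : IsTorAcyclic A :=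
  fun I hI i => h.extVanishes_left (hB I hI i) (hC I hI (i + 1))

lemma ExtVanishes.of_linearEquiv {M N X : ModuleCat.{u} S} {i : ℕ} (e : M ≃ₗ[S] N)
    (hN : ExtVanishes (i + 1) N X) : ExtVanishes (i + 1) M X := by
  have h : IsShortExact (A := ModuleCat.of S PUnit.{u + 1}) (0 : _ →ₗ[S] M) e.toLinearMap :=
    ⟨Function.injective_of_subsingleton _, e.surjective, fun x =>
      ⟨fun hx => ⟨0, (e.map_eq_zero_iff.1 hx).symm⟩, by rintro ⟨_, rfl⟩; exact map_zero e⟩⟩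
  exact h.extVanishes_middle (extVanishes_of_projective i _ X) hN

lemma isShortExact_range {A B C : ModuleCat.{u} S} (f : A →ₗ[S] B) (g : B →ₗ[S] C)
    (h : Function.Exact f g) : IsShortExact (LinearMap.range f).subtype g.rangeRestrict :=
  ⟨Subtype.val_injective, g.surjective_rangeRestrict, fun x => by
    rw [Submodule.coe_subtype, Subtype.range_coe_subtype, ← LinearMap.mem_ker,
      LinearMap.ker_rangeRestrict, LinearMap.mem_ker]
    exact h x⟩

/-- Gorenstein flat modules are acyclic for tensoring with injective right modules. -/
lemma IsGorensteinFlat.isTorAcyclic {G : ModuleCat.{u} S} (hG : IsGorensteinFlat S G) :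
    IsTorAcyclic G := by
  obtain ⟨F, d, hF, hd, ⟨e⟩, hI⟩ := hG
  intro I hIinj i
  suffices H : ∀ n, ExtVanishes (i + 1) (ModuleCat.of S (LinearMap.range (d n)))
      (characterCat I) from ExtVanishes.of_linearEquiv (N := ModuleCat.of S _) e (H 0)
  have hses := fun n => isShortExact_range (d n) (d (n + 1)) (hd n)
  induction i with
  | zero =>
    intro n
    obtain ⟨m, rfl⟩ : ∃ m : ℤ, n = m + 1 + 1 := ⟨n - 2, by ring⟩
    refine (hses (m + 1)).extVanishes_one (A := ModuleCat.of S _) (C := ModuleCat.of S _)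
      ((hF _).extVanishes I 0) fun φ => ?_
    obtain ⟨ψ, hψ⟩ := (NTensor.rmap_exact_iff (d m) (d (m + 1))
      (hd m).apply_apply_eq_zero).1 (hI I hIinj m) (φ ∘ₗ (d (m + 1)).rangeRestrict) fun x => by
        have : (d (m + 1)).rangeRestrict (d m x) = 0 :=
          Subtype.ext ((hd m).apply_apply_eq_zero x)
        rw [LinearMap.comp_apply, this, map_zero]
    refine ⟨ψ, ?_⟩
    rintro ⟨_, x, rfl⟩
    exact hψ x
  | succ i ih =>
    intro n
    obtain ⟨m, rfl⟩ : ∃ m : ℤ, n = m + 1 := ⟨n - 1, by ring⟩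
    exact (hses m).extVanishes_right (A := ModuleCat.of S _) (C := ModuleCat.of S _)
      (ih m) ((hF _).extVanishes I _)

/-- A Gorenstein flat module embeds into a flat one with Gorenstein flat cokernel. -/
lemma IsGorensteinFlat.exists_flat_embedding {G : ModuleCat.{u} S} (hG : IsGorensteinFlat S G) :
    ∃ (F C : ModuleCat.{u} S) (f : G →ₗ[S] F) (g : F →ₗ[S] C),
      IsShortExact f g ∧ IsFlatMod S F ∧ IsGorensteinFlat S C := by
  obtain ⟨F, d, hF, hd, ⟨e⟩, hI⟩ := hG
  have h := isShortExact_range (d 0) (d (0 + 1)) (hd 0)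
  refine ⟨F (0 + 1), ModuleCat.of S (LinearMap.range (d (0 + 1))),
    (LinearMap.range (d 0)).subtype ∘ₗ e.toLinearMap, (d (0 + 1)).rangeRestrict,
    ⟨h.injective.comp e.injective, h.surjective, fun x => ?_⟩, hF _,
    ⟨fun n => F (n + 1), fun n => d (n + 1), fun n => hF _, fun n => hd _,
      ⟨LinearEquiv.refl S _⟩, fun I _ _ hIinj n => hI I hIinj _⟩⟩
  rw [h.exact x]
  exact ⟨fun ⟨y, hy⟩ => ⟨e.symm y, by simpa using hy⟩, fun ⟨y, hy⟩ => ⟨e y, hy⟩⟩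

lemma isGorensteinFlat_of_int_sequence (Z : ℤ → ModuleCat.{u} S) (hZ : ∀ n, IsTorAcyclic (Z n))
    (hstep : ∀ n, ∃ (F : ModuleCat.{u} S) (f : Z n →ₗ[S] F) (g : F →ₗ[S] Z (n + 1)),
      IsFlatMod S F ∧ IsShortExact f g) : IsGorensteinFlat S (Z (0 + 1)) := by
  choose F i p hF h using hstep
  have hd : ∀ n, Function.Exact (i (n + 1) ∘ₗ p n) (i (n + 1 + 1) ∘ₗ p (n + 1)) := fun n x => by
    rw [LinearMap.comp_apply, map_eq_zero_iff _ (h _).injective, (h (n + 1)).exact x,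
      LinearMap.coe_comp, (h n).surjective.range_comp]
  refine ⟨F, fun n => i (n + 1) ∘ₗ p n, hF, hd,
    ⟨(LinearEquiv.ofInjective (i (0 + 1)) (h _).injective).trans (LinearEquiv.ofEq _ _ ?_)⟩, ?_⟩
  · rw [LinearMap.range_comp_of_range_eq_top _ (LinearMap.range_eq_top.2 (h 0).surjective)]
  · intro I _ _ hI n
    rw [NTensor.rmap_exact_iff _ _ (hd n).apply_apply_eq_zero]
    intro χ hχ
    obtain ⟨φ, hφ⟩ := (h (n + 1)).exists_lift χ fun z => by
      obtain ⟨y, rfl⟩ := (h n).surjective z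
      exact hχ y
    obtain ⟨ψ, hψ⟩ := (h (n + 1 + 1)).exists_extension
      (X := characterCat (ModuleCat.of Sᵐᵒᵖ I)) (hZ _ (ModuleCat.of Sᵐᵒᵖ I) hI 0) φ
    exact ⟨ψ, fun x => (hψ _).trans (hφ x)⟩

/-- Coinduction principle for Gorenstein flat modules. -/
lemma isGorensteinFlat_of_class (𝒞 : ModuleCat.{u} S → Prop) (hacyc : ∀ M, 𝒞 M → IsTorAcyclic M)
    (hstep : ∀ M, 𝒞 M → ∃ (F C : ModuleCat.{u} S) (f : M →ₗ[S] F) (g : F →ₗ[S] C),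
      IsShortExact f g ∧ IsFlatMod S F ∧ 𝒞 C)
    (M : ModuleCat.{u} S) (hM : 𝒞 M) : IsGorensteinFlat S M := by
  have hnext : ∀ X : {X : ModuleCat.{u} S // 𝒞 X}, ∃ Y : {X : ModuleCat.{u} S // 𝒞 X},
      ∃ (F : ModuleCat.{u} S) (f : X.1 →ₗ[S] F) (g : F →ₗ[S] Y.1),
        IsFlatMod S F ∧ IsShortExact f g := fun X => by
    obtain ⟨F, C, f, g, h, hF, hC⟩ := hstep X.1 X.2
    exact ⟨⟨C, hC⟩, F, f, g, hF, h⟩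
  have hprev : ∀ X : {X : ModuleCat.{u} S // IsTorAcyclic X},
      ∃ Y : {X : ModuleCat.{u} S // IsTorAcyclic X},
      ∃ (F : ModuleCat.{u} S) (f : Y.1 →ₗ[S] F) (g : F →ₗ[S] X.1),
        IsFlatMod S F ∧ IsShortExact f g := fun X => by
    obtain ⟨K, P, f, g, h, hP⟩ := exists_projective_presentation X.1
    have hflat := isFlatMod_of_projective P
    exact ⟨⟨K, h.isTorAcyclic_left hflat.isTorAcyclic X.2⟩, P, f, g, hflat, h⟩
  choose next hnext using hnext
  choose prev hprev using hprev
  let Zp : ℕ → {X : ModuleCat.{u} S // 𝒞 X} := fun n => next^[n] ⟨M, hM⟩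
  let Zn : ℕ → {X : ModuleCat.{u} S // IsTorAcyclic X} := fun n => prev^[n] ⟨M, hacyc M hM⟩
  have hZp : ∀ n, Zp (n + 1) = next (Zp n) := fun n => Function.iterate_succ_apply' _ _ _
  have hZn : ∀ n, Zn (n + 1) = prev (Zn n) := fun n => Function.iterate_succ_apply' _ _ _
  let Z : ℤ → ModuleCat.{u} S := fun
    | Int.ofNat 0 => Zn 1
    | Int.ofNat (n + 1) => Zp n
    | Int.negSucc n => Zn (n + 2)
  refine isGorensteinFlat_of_int_sequence Z ?_ ?_
  · rintro ((_ | n) | n)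
    · exact (Zn 1).2
    · exact hacyc _ (Zp n).2
    · exact (Zn (n + 2)).2
  · rintro ((_ | n) | (_ | n))
    · exact hprev ⟨M, hacyc M hM⟩
    · have := hnext (Zp n)
      rw [← hZp] at this
      exact this
    · exact hprev (Zn 1)
    · have := hprev (Zn (n + 2))
      rw [← hZn] at this
      exact this

lemma IsFlatMod.isGorensteinFlat {F : ModuleCat.{u} S} (hF : IsFlatMod S F) :
    IsGorensteinFlat S F := by
  refine isGorensteinFlat_of_class (IsFlatMod S) (fun M hM => hM.isTorAcyclic)
    (fun M hM => ⟨M, ModuleCat.of S PUnit.{u + 1}, LinearMap.id, 0,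
      ⟨Function.injective_id, fun x => ⟨0, Subsingleton.elim _ _⟩, fun x => ?_⟩, hM,
      isFlatMod_of_projective _⟩) F hF
  simp

lemma isGorensteinFlat_of_flat_embedding {K F C : ModuleCat.{u} S} {f : K →ₗ[S] F} {g : F →ₗ[S] C}
    (h : IsShortExact f g) (hK : IsTorAcyclic K) (hF : IsFlatMod S F)
    (hC : IsGorensteinFlat S C) : IsGorensteinFlat S K := by
  refine isGorensteinFlat_of_class (fun M => M = K ∨ IsGorensteinFlat S M) ?_ ?_ K (Or.inl rfl)
  · rintro M (rfl | hM)
    exacts [hK, hM.isTorAcyclic]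
  · rintro M (rfl | hM)
    · exact ⟨F, C, f, g, h, hF, Or.inr hC⟩
    · obtain ⟨F, C, f, g, h, hF, hC⟩ := hM.exists_flat_embedding
      exact ⟨F, C, f, g, h, hF, Or.inr hC⟩

/-- Over a GF-closed ring, acyclic modules of finite Gorenstein flat dimension are
Gorenstein flat. -/
lemma IsTorAcyclic.isGorensteinFlat (hS : IsGFClosed S) {m : ℕ} {K : ModuleCat.{u} S}
    (hK : IsTorAcyclic K) (hm : gflatDimLE S m K) : IsGorensteinFlat S K := by
  induction m generalizing K with
  | zero => exact hm
  | succ m ih =>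
    obtain ⟨K', G, i, p, hi, hp, hip, hG, hK'⟩ := hm
    have h : IsShortExact i p := ⟨hi, hp, hip⟩
    have hK'G := ih (h.isTorAcyclic_left hG.isTorAcyclic hK) hK'
    obtain ⟨F', C', f', g', h', hF', hC'⟩ := hK'G.exists_flat_embedding
    obtain ⟨D, j, q, j', q', hD, hD'⟩ := h.exists_pushout h'
    have hDG := hS G D C' j q hD.injective hD.surjective hD.exact hG hC'
    obtain ⟨F, C, f, g, hF, hFflat, hC⟩ := hDG.exists_flat_embedding
    obtain ⟨Q, r, s, t, hQ, hQ'⟩ := hD'.exists_quotient hF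
    have hinj := (isFlatMod_iff_injective_character F').1 hF'
    have hQflat := hQ.isFlatMod_right hFflat
      (hQ'.extVanishes_middle (hK (.of _ (CharacterModule F')) hinj 0)
        (hC.isTorAcyclic (.of _ (CharacterModule F')) hinj 0))
    exact isGorensteinFlat_of_flat_embedding hQ' hK hQflat hC

end GorensteinFlat

section Dimensions

variable {S : Type u} [Ring S]

lemma ENat.sInf_le_iff_exists {p : ℕ → Prop} {n : ℕ} :
    sInf {d : ℕ∞ | ∃ k : ℕ, d = k ∧ p k} ≤ n ↔ ∃ k ≤ n, p k := by
  constructor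
  · intro h
    have hne : {d : ℕ∞ | ∃ k : ℕ, d = k ∧ p k}.Nonempty := by
      by_contra hemp
      rw [Set.not_nonempty_iff_eq_empty.1 hemp, sInf_empty, top_le_iff] at h
      exact ENat.natCast_ne_top n h
    obtain ⟨k, hk, hpk⟩ := csInf_mem hne
    rw [hk] at h
    exact ⟨k, by exact_mod_cast h, hpk⟩
  · rintro ⟨k, hk, hpk⟩
    have hmem : (k : ℕ∞) ∈ {d : ℕ∞ | ∃ k : ℕ, d = k ∧ p k} := ⟨k, rfl, hpk⟩
    exact (sInf_le hmem).trans (by exact_mod_cast hk)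

lemma ENat.sInf_ne_top_iff_exists {p : ℕ → Prop} :
    sInf {d : ℕ∞ | ∃ k : ℕ, d = k ∧ p k} ≠ ⊤ ↔ ∃ k, p k := by
  rw [ENat.ne_top_iff_exists]
  constructor
  · rintro ⟨n, hn⟩
    obtain ⟨k, -, hk⟩ := ENat.sInf_le_iff_exists.1 hn.ge
    exact ⟨k, hk⟩
  · rintro ⟨k, hk⟩
    exact ENat.ne_top_iff_exists.1
      (ne_top_of_le_ne_top (ENat.natCast_ne_top k) (ENat.sInf_le_iff_exists.2 ⟨k, le_rfl, hk⟩))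

lemma IsGorensteinFlat.extVanishes_of_injDimLE {G : ModuleCat.{u} S} (hG : IsGorensteinFlat S G)
    {k : ℕ} {E : ModuleCat.{u} Sᵐᵒᵖ} (hE : injDimLE Sᵐᵒᵖ k E) (i : ℕ) :
    ExtVanishes (i + 1) G (characterCat E) := by
  induction k generalizing E i with
  | zero => exact hG.isTorAcyclic E hE i
  | succ k ih =>
    obtain ⟨I, C, f, g, hf, hg, hfg, hI, hC⟩ := hE
    have h : IsShortExact f g := ⟨hf, hg, hfg⟩
    exact h.dualRight.extVanishes_target_right (A := characterCat C) (B := characterCat I)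
      (C := characterCat E) (hG.isTorAcyclic I hI i) (ih hC (i + 1))

lemma extVanishes_of_gflatDimLE_of_injDimLE {m k : ℕ} {M : ModuleCat.{u} S}
    (hM : gflatDimLE S m M) {E : ModuleCat.{u} Sᵐᵒᵖ} (hE : injDimLE Sᵐᵒᵖ k E) {i : ℕ}
    (hi : m ≤ i) : ExtVanishes (i + 1) M (characterCat E) := by
  induction m generalizing M i with
  | zero => exact IsGorensteinFlat.extVanishes_of_injDimLE hM hE i
  | succ m ih =>
    obtain ⟨K, G, f, g, hf, hg, hfg, hG, hK⟩ := hM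
    have h : IsShortExact f g := ⟨hf, hg, hfg⟩
    obtain ⟨j, rfl⟩ : ∃ j, i = j + 1 := ⟨i - 1, by lia⟩
    exact h.extVanishes_right (ih hK (by lia)) (hG.extVanishes_of_injDimLE hE _)

lemma flatDimLE_of_extVanishes {n : ℕ} {E : ModuleCat.{u} Sᵐᵒᵖ}
    (hE : ∀ M : ModuleCat.{u} S, ExtVanishes (n + 1) M (characterCat E)) :
    flatDimLE Sᵐᵒᵖ n E := by
  induction n generalizing E with
  | zero =>
    exact (isFlatMod_op_iff_injective_character E).2 (injective_of_extVanishes_one _ hE)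
  | succ n ih =>
    obtain ⟨K, P, f, g, h, hP⟩ := exists_projective_presentation E
    refine ⟨K, P, f, g, h.injective, h.surjective, h.exact, isFlatMod_of_projective P,
      ih fun M => ?_⟩
    exact h.dualRight.extVanishes_target_right (A := characterCat E) (B := characterCat P)
      (C := characterCat K)
      (extVanishes_of_injective n M _ (injective_character_of_projective P)) (hE M)

lemma extVanishes_of_flatDimLE {m : ℕ} {E : ModuleCat.{u} Sᵐᵒᵖ} (hE : flatDimLE Sᵐᵒᵖ m E)
    (M : ModuleCat.{u} S) {i : ℕ} (hi : m ≤ i) : ExtVanishes (i + 1) M (characterCat E) := by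
  induction m generalizing E i with
  | zero =>
    exact extVanishes_of_injective i M _ ((isFlatMod_op_iff_injective_character E).1 hE)
  | succ m ih =>
    obtain ⟨K, F, f, g, hf, hg, hfg, hF, hK⟩ := hE
    have h : IsShortExact f g := ⟨hf, hg, hfg⟩
    obtain ⟨j, rfl⟩ : ∃ j, i = j + 1 := ⟨i - 1, by lia⟩
    exact h.dualRight.extVanishes_target_left (A := characterCat E) (B := characterCat F)
      (C := characterCat K)
      (extVanishes_of_injective _ M _ ((isFlatMod_op_iff_injective_character F).1 hF))
      (ih hK (by lia))

lemma gflatDimLE_of_extVanishes (hS : IsGFClosed S)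
    (hfin : ∀ M : ModuleCat.{u} S, ∃ m, gflatDimLE S m M)
    {n : ℕ} {M : ModuleCat.{u} S}
    (hM : ∀ I : ModuleCat.{u} Sᵐᵒᵖ, Module.Injective Sᵐᵒᵖ I →
      ∀ i, n ≤ i → ExtVanishes (i + 1) M (characterCat I)) : gflatDimLE S n M := by
  induction n generalizing M with
  | zero =>
    obtain ⟨m, hm⟩ := hfin M
    have hacyc : IsTorAcyclic M := fun I hI i => hM I hI i (Nat.zero_le i)
    exact hacyc.isGorensteinFlat hS hm
  | succ n ih =>
    obtain ⟨K, P, f, g, h, hP⟩ := exists_projective_presentation M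
    refine ⟨K, P, f, g, h.injective, h.surjective, h.exact,
      (isFlatMod_of_projective P).isGorensteinFlat, ih fun I hI i hi => ?_⟩
    exact h.extVanishes_left (extVanishes_of_projective i P _) (hM I hI (i + 1) (by lia))

end Dimensions

/-- **Lemma 2.4 (1 ⇔ 5).**  If `R` is a left GF-closed ring with `l.Gwdim(R) < ∞` and `n` is a
positive integer, then `l.Gwdim(R) ≤ n` iff `fd_R(E') ≤ n` for every right `R`-module `E'` of
finite injective dimension. -/
theorem gorensteinWeakGlobalDim_le_iff_flatDim_finiteInjDim_le (R : Type u) [Ring R]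
    (h : IsGFClosed R) (hfin : gorensteinWeakGlobalDim R ≠ ⊤) (n : ℕ) (hn : 0 < n) :
    gorensteinWeakGlobalDim R ≤ (n : ℕ∞) ↔
      ∀ E' : ModuleCat.{u} Rᵐᵒᵖ, injDim Rᵐᵒᵖ E' ≠ ⊤ → flatDim Rᵐᵒᵖ E' ≤ (n : ℕ∞) := by
  rw [gorensteinWeakGlobalDim, iSup_le_iff]
  constructor
  · intro hle E' hE'
    obtain ⟨k, hk⟩ := ENat.sInf_ne_top_iff_exists.1 hE'
    refine ENat.sInf_le_iff_exists.2 ⟨n, le_rfl, flatDimLE_of_extVanishes fun M => ?_⟩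
    obtain ⟨m, hmn, hm⟩ := ENat.sInf_le_iff_exists.1 (hle M)
    exact extVanishes_of_gflatDimLE_of_injDimLE hm hk hmn
  · intro hflat M
    have hfin' : ∀ M : ModuleCat.{u} R, ∃ m, gflatDimLE R m M := fun M =>
      ENat.sInf_ne_top_iff_exists.1 (ne_top_of_le_ne_top hfin (le_iSup (gflatDim R) M))
    refine ENat.sInf_le_iff_exists.2 ⟨n, le_rfl, gflatDimLE_of_extVanishes h hfin'
      fun I hI i hi => ?_⟩
    obtain ⟨m, hmn, hm⟩ := ENat.sInf_le_iff_exists.1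
      (hflat I (ENat.sInf_ne_top_iff_exists.2 ⟨0, hI⟩))
    exact extVanishes_of_flatDimLE hm M (hmn.trans hi)
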